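/- arXiv:1011.6441 — 6 statements merged into one kernel-verified Lean document; each statement's English description precedes it below -/
import Mathlib

section
/- Pairwise error probability. Let n ≥ 1, s ∈ ℝⁿ, σ > 0, and let X and X̃ be n×n real matrices with X̃ s ≠ X s. Let z = (z₁,…,z_n) be distributed according to the product measure on ℝⁿ whose coordinates are i.i.d. Gaussian with mean 0 and variance σ², and set y = X s + z. Then the probability of the event { yᵀ(X̃ s) ≥ yᵀ(X s) } equals Q( D_s(X, X̃) / σ ), where D_s(X, X̃) = (‖X s‖² − (X̃ s)ᵀ(X s)) / ‖X̃ s − X s‖. -/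
open Matrix Finset MeasureTheory ProbabilityTheory

/-- The Gaussian Q-function: the tail of the standard normal distribution. -/
noncomputable def Qfun (x : ℝ) : ℝ :=
  ∫ t in Set.Ioi x, (Real.sqrt (2 * Real.pi))⁻¹ * Real.exp (-t ^ 2 / 2)

/-- A linear functional of a vector of i.i.d. centred Gaussians is a centred Gaussian. -/
lemma map_dotProduct_pi_gaussianReal {ι : Type*} [Fintype ι] (v u : NNReal) (w : ι → ℝ)
    (hu : (v : ℝ) * ∑ i, w i ^ 2 = u) :
    (Measure.pi fun _ : ι => gaussianReal 0 v).map (fun z => z ⬝ᵥ w) = gaussianReal 0 u := by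
  have hm : Measurable fun z : ι → ℝ => z ⬝ᵥ w := by
    unfold dotProduct
    fun_prop
  have : IsProbabilityMeasure ((Measure.pi fun _ : ι => gaussianReal 0 v).map (fun z => z ⬝ᵥ w)) :=
    Measure.isProbabilityMeasure_map hm.aemeasurable
  refine Measure.ext_of_charFun ?_
  ext t
  rw [charFun_apply_real, integral_map hm.aemeasurable (by fun_prop), charFun_gaussianReal]
  have hprod (z : ι → ℝ) : Complex.exp (t * ((z ⬝ᵥ w : ℝ) : ℂ) * Complex.I) =
      ∏ i, Complex.exp (((t * w i : ℝ) : ℂ) * (z i : ℂ) * Complex.I) := by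
    rw [← Complex.exp_sum]
    congr 1
    simp only [dotProduct, Complex.ofReal_sum, Finset.mul_sum, Finset.sum_mul]
    refine Finset.sum_congr rfl fun i _ => ?_
    push_cast
    ring
  simp_rw [hprod]
  rw [integral_fintype_prod_eq_prod
    (f := fun i (x : ℝ) => Complex.exp (((t * w i : ℝ) : ℂ) * (x : ℂ) * Complex.I))]
  simp_rw [← charFun_apply_real, charFun_gaussianReal]
  rw [← Complex.exp_sum]
  congr 1
  have hu' : (v : ℂ) * ∑ i, (w i : ℂ) ^ 2 = u := by exact_mod_cast congrArg Complex.ofReal hu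
  rw [← hu', Finset.mul_sum, Finset.sum_mul, Finset.sum_div]
  simp only [Complex.ofReal_zero, mul_zero, zero_mul, zero_sub, Finset.sum_neg_distrib]
  congr 1
  refine Finset.sum_congr rfl fun i _ => ?_
  push_cast
  ring

lemma gaussianReal_Ici_eq_Qfun (x : ℝ) :
    gaussianReal 0 1 (Set.Ici x) = ENNReal.ofReal (Qfun x) := by
  rw [gaussianReal_apply_eq_integral _ one_ne_zero, integral_Ici_eq_integral_Ioi]
  simp [Qfun, gaussianPDFReal_def]

/-- Pairwise error probability: with `y = X s + z` and `z` i.i.d. Gaussian noise of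
mean `0` and variance `σ²`, the probability that `yᵀ(X̃ s) ≥ yᵀ(X s)` equals
`Q(D_s(X, X̃) / σ)` where `D_s(X, X̃) = (‖X s‖² − (X̃ s)ᵀ(X s)) / ‖X̃ s − X s‖`. -/
theorem stmt3 (n : ℕ) (hn : 1 ≤ n) (s : Fin n → ℝ) (σ : ℝ) (hσ : 0 < σ)
    (X Xt : Matrix (Fin n) (Fin n) ℝ)
    (hne : Xt.mulVec s ≠ X.mulVec s) :
    (Measure.pi fun _ : Fin n => gaussianReal 0 ⟨σ ^ 2, sq_nonneg σ⟩)
      {z : Fin n → ℝ |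
        (X.mulVec s + z) ⬝ᵥ Xt.mulVec s ≥ (X.mulVec s + z) ⬝ᵥ X.mulVec s}
    = ENNReal.ofReal (Qfun
        ((((∑ i, (X.mulVec s i) ^ 2) - Xt.mulVec s ⬝ᵥ X.mulVec s) /
            Real.sqrt (∑ i, (Xt.mulVec s i - X.mulVec s i) ^ 2)) / σ)) := by
  set a := X.mulVec s
  set b := Xt.mulVec s
  set r := Real.sqrt (∑ i, (b i - a i) ^ 2)
  have hpos : 0 < ∑ i, (b i - a i) ^ 2 := by
    obtain ⟨i, hi⟩ := Function.ne_iff.mp hne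
    exact Finset.sum_pos' (fun _ _ => sq_nonneg _)
      ⟨i, Finset.mem_univ i, sq_pos_of_ne_zero (sub_ne_zero.mpr hi)⟩
  have hr : 0 < r := Real.sqrt_pos.mpr hpos
  have hr2 : r ^ 2 = ∑ i, (b i - a i) ^ 2 := Real.sq_sqrt hpos.le
  have hlaw := map_dotProduct_pi_gaussianReal ⟨σ ^ 2, sq_nonneg σ⟩ 1 ((r * σ)⁻¹ • (b - a)) (by
    simp only [Pi.smul_apply, Pi.sub_apply, smul_eq_mul, mul_pow, ← Finset.mul_sum, ← hr2,
      NNReal.coe_one]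
    field_simp
    rfl)
  rw [← gaussianReal_Ici_eq_Qfun, ← hlaw, Measure.map_apply (by unfold dotProduct; fun_prop)
    measurableSet_Ici]
  congr 1
  ext z
  have ha : ∑ i, a i ^ 2 = a ⬝ᵥ a := by simp [dotProduct, sq]
  simp only [Set.mem_ofPred_eq, Set.mem_preimage, Set.mem_Ici, ha, div_div, dotProduct_smul,
    smul_eq_mul, inv_mul_eq_div, ge_iff_le]
  rw [div_le_div_iff_of_pos_right (mul_pos hr hσ), dotProduct_sub, add_dotProduct, add_dotProduct,
    dotProduct_comm b a]
  constructor <;> intro h <;> linarith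
end

section
/- Let n be a positive even integer and let s ∈ ℝⁿ have pairwise distinct entries. If σ and τ are two distinct pure involutions of {1,…,n} (i.e., σ∘σ = id, τ∘τ = id, and σ, τ have no fixed points), then the Hamming distance between the codewords s∘σ and s∘τ is at least 4; that is, the entries s_{σ(i)} and s_{τ(i)} differ for at least 4 indices i. -/
open Finset

/-- Two distinct pure involutions (fixed-point-free involutions) `σ ≠ τ` of `{1,…,n}`
(`n` even) yield codewords `s∘σ`, `s∘τ` at Hamming distance at least `4`, when the
initial vector `s` has pairwise distinct entries. -/
theorem stmt6 (n : ℕ) (hn : 0 < n) (hEven : Even n)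
    (s : Fin n → ℝ) (hs : Function.Injective s)
    (σ τ : Equiv.Perm (Fin n))
    (hσ1 : ∀ i, σ (σ i) = i) (hσ2 : ∀ i, σ i ≠ i)
    (hτ1 : ∀ i, τ (τ i) = i) (hτ2 : ∀ i, τ i ≠ i)
    (hne : σ ≠ τ) :
    4 ≤ Nat.card {i : Fin n // s (σ i) ≠ s (τ i)} := by
  simp only [hs.ne_iff, Nat.card_eq_fintype_card, Fintype.card_subtype]
  obtain ⟨i, hi⟩ : ∃ i, σ i ≠ τ i := by
    by_contra! h
    exact hne (Equiv.ext h)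
  have hσ := σ.injective
  have hcard : #{i, σ i, τ i, σ (τ i)} = 4 := by
    have := hσ2 i
    have := hτ2 i
    have := hσ2 (τ i)
    have : i ≠ σ (τ i) := fun h => hi (by rw [h, hσ1, ← h])
    have : σ i ≠ σ (τ i) := hσ.ne (hτ2 i).symm
    rw [card_insert_of_notMem, card_insert_of_notMem, card_pair] <;> grind
  rw [← hcard]
  refine card_le_card fun j hj => ?_
  simp only [mem_insert, mem_singleton] at hj
  simp only [mem_filter, mem_univ, true_and]
  grind
end

section
/- Minimum Hamming distance of pure involution codes. Let n ≥ 4 be an even integer and let s ∈ ℝⁿ have pairwise distinct entries. Then the minimum Hamming distance of the pure involution code equals 4: for all distinct pure involutions σ ≠ τ of {1,…,n} one has d_H(s∘σ, s∘τ) ≥ 4, and there exist distinct pure involutions σ, τ with d_H(s∘σ, s∘τ) = 4. -/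
open Finset

/-- If two fixed-point-free involutions disagree at `i`, then they also disagree at `σ i`, `τ i`
and `σ (τ i)`, and these four points are distinct. -/
theorem four_le_card_ne_of_involutive {α : Type*} [Fintype α] [DecidableEq α]
    {σ τ : Equiv.Perm α} (hσ : ∀ i, σ (σ i) = i) (hσ' : ∀ i, σ i ≠ i)
    (hτ : ∀ i, τ (τ i) = i) (hτ' : ∀ i, τ i ≠ i) (hne : σ ≠ τ) :
    4 ≤ #{i | σ i ≠ τ i} := by
  obtain ⟨i, hi⟩ : ∃ i, σ i ≠ τ i := by
    contrapose! hne
    exact Equiv.ext hne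
  have hcard : #{i, σ i, τ i, σ (τ i)} = 4 := by
    rw [card_insert_of_notMem, card_insert_of_notMem, card_pair] <;> grind
  rw [← hcard]
  apply card_le_card
  intro x hx
  simp only [mem_insert, mem_singleton] at hx
  rw [mem_filter_univ]
  grind

/-- The map swapping `2k` and `2k + 1` for every `k`. -/
def swapAdjacent (i : ℕ) : ℕ := if i % 2 = 0 then i + 1 else i - 1

/-- The map agreeing with `swapAdjacent` from `4` on, and swapping `0` with `2` and `1` with `3`. -/
def swapCrossed (i : ℕ) : ℕ :=
  if i < 2 then i + 2 else if i < 4 then i - 2 else swapAdjacent i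

/-- The permutation of `Fin n` induced by an involution of `ℕ` preserving `{0, …, n - 1}`. -/
def finPermOfInvolutive {n : ℕ} (f : ℕ → ℕ) (hf : f.Involutive) (h : ∀ i < n, f i < n) :
    Equiv.Perm (Fin n) :=
  Function.Involutive.toPerm (fun i => ⟨f i, h i i.2⟩) fun i => Fin.ext (hf i)

theorem swapAdjacent_involutive : swapAdjacent.Involutive := by
  intro i
  grind [swapAdjacent]

theorem swapCrossed_involutive : swapCrossed.Involutive := by
  intro i
  grind [swapAdjacent, swapCrossed]

theorem swapAdjacent_ne (i : ℕ) : swapAdjacent i ≠ i := by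
  grind [swapAdjacent]

theorem swapCrossed_ne (i : ℕ) : swapCrossed i ≠ i := by
  grind [swapAdjacent, swapCrossed]

theorem swapAdjacent_lt {n : ℕ} (hn : Even n) (i : ℕ) (hi : i < n) : swapAdjacent i < n := by
  grind [swapAdjacent]

theorem swapCrossed_lt {n : ℕ} (h4 : 4 ≤ n) (hn : Even n) (i : ℕ) (hi : i < n) :
    swapCrossed i < n := by
  grind [swapAdjacent, swapCrossed]

theorem swapAdjacent_ne_swapCrossed_iff (i : ℕ) : swapAdjacent i ≠ swapCrossed i ↔ i < 4 := by
  grind [swapAdjacent, swapCrossed]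

/-- The minimum Hamming distance of the pure involution code of even length `n ≥ 4`
equals `4`: every pair of distinct pure involutions gives codewords differing in at least
`4` coordinates, and some pair gives codewords differing in exactly `4` coordinates. -/
theorem stmt7 (n : ℕ) (hn : 4 ≤ n) (hEven : Even n)
    (s : Fin n → ℝ) (hs : Function.Injective s) :
    (∀ σ τ : Equiv.Perm (Fin n),
      (∀ i, σ (σ i) = i) → (∀ i, σ i ≠ i) →
      (∀ i, τ (τ i) = i) → (∀ i, τ i ≠ i) → σ ≠ τ →
      4 ≤ Nat.card {i : Fin n // s (σ i) ≠ s (τ i)}) ∧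
    (∃ σ τ : Equiv.Perm (Fin n),
      (∀ i, σ (σ i) = i) ∧ (∀ i, σ i ≠ i) ∧
      (∀ i, τ (τ i) = i) ∧ (∀ i, τ i ≠ i) ∧ σ ≠ τ ∧
      Nat.card {i : Fin n // s (σ i) ≠ s (τ i)} = 4) := by
  have hcard (σ τ : Equiv.Perm (Fin n)) :
      Nat.card {i : Fin n // s (σ i) ≠ s (τ i)} = #{i | σ i ≠ τ i} := by
    simp only [hs.ne_iff, Nat.card_eq_fintype_card, Fintype.card_subtype]
  simp only [hcard]
  refine ⟨fun σ τ hσ hσ' hτ hτ' hne => four_le_card_ne_of_involutive hσ hσ' hτ hτ' hne, ?_⟩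
  let σ := finPermOfInvolutive swapAdjacent swapAdjacent_involutive (swapAdjacent_lt hEven)
  let τ := finPermOfInvolutive swapCrossed swapCrossed_involutive (swapCrossed_lt hn hEven)
  have hne_iff (i : Fin n) : σ i ≠ τ i ↔ (i : ℕ) < 4 :=
    (Fin.ext_iff.not).trans (swapAdjacent_ne_swapCrossed_iff i)
  refine ⟨σ, τ, fun i => Fin.ext (swapAdjacent_involutive i),
    fun i h => swapAdjacent_ne i (Fin.ext_iff.mp h), fun i => Fin.ext (swapCrossed_involutive i),
    fun i h => swapCrossed_ne i (Fin.ext_iff.mp h), ?_, ?_⟩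
  · intro h
    exact (hne_iff ⟨0, by lia⟩).mpr (by simp) (by rw [h])
  · simp only [hne_iff, Fin.card_filter_val_lt]
    lia
end

section
/- Characterization of block permutation matrices. Let γ, ν ≥ 1 and n = γν, and index rows and columns of an n×n matrix by pairs (k, i) with k ∈ {1,…,γ} (block index) and i ∈ {1,…,ν} (position within block). Let X be an n×n permutation matrix. Then X is a block permutation matrix if and only if for all block indices k, b ∈ {1,…,γ} and every subindex l ∈ {1,…,ν}, Σ_{i=1}^{ν} X_{(k,i),(b,l)} + Σ_{k' ≠ k} Σ_{i=1}^{ν} X_{(k',i),(b,l⁺)} = 1, where l⁺ = (l mod ν) + 1 is the cyclic successor of l. (The left-hand side is the sum of entries of X over the skewed column set U_{k,b}^{(l)}.) -/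
open Matrix Finset

/-- A permutation matrix: entries lie in `{0, 1}` and every row sum and column sum is `1`. -/
def IsPermMatrix {α : Type*} [Fintype α] (X : Matrix α α ℝ) : Prop :=
  (∀ i j, X i j = 0 ∨ X i j = 1) ∧ (∀ i, ∑ j, X i j = 1) ∧ (∀ j, ∑ i, X i j = 1)

/-- A block permutation matrix (rows and columns indexed by block index in `Fin γ` and
position in `Fin ν`): for every column block index `b` there is exactly one row block
index `k` such that the submatrix on block `B_{k,b}` is nonzero. -/
def IsBlockPermMatrix {γ ν : ℕ} (X : Matrix (Fin γ × Fin ν) (Fin γ × Fin ν) ℝ) : Prop :=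
  ∀ b : Fin γ, ∃! k : Fin γ, ∃ i j : Fin ν, X (k, i) (b, j) ≠ 0

theorem Fin.eq_of_forall_eq_add_one {ν : ℕ} [NeZero ν] {β : Type*} {f : Fin ν → β}
    (h : ∀ l, f l = f (l + 1)) (l : Fin ν) : f l = f 0 := by
  have key : ∀ (m : ℕ) (hm : m < ν), f ⟨m, hm⟩ = f 0 := by
    intro m
    induction m with
    | zero => intro hm; rfl
    | succ m ih =>
      intro hm
      rw [← ih (by omega), h ⟨m, by omega⟩]
      congr 1
      ext
      simp [Fin.val_add, Nat.mod_eq_of_lt hm]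
  exact key l l.2

theorem IsPermMatrix.nonneg {α : Type*} [Fintype α] {X : Matrix α α ℝ} (hX : IsPermMatrix X)
    (i j : α) : 0 ≤ X i j := by
  rcases hX.1 i j with h | h <;> simp [h]

/-- Characterization of block permutation matrices: a permutation matrix `X` is a block
permutation matrix iff for all block indices `k, b` and every subindex `l`, the sum of the
entries of `X` over the skewed column set `U_{k,b}^{(l)}` equals `1` (here `l + 1` is the
cyclic successor of `l` in `Fin ν`). -/
theorem stmt9 (γ ν : ℕ) [NeZero γ] [NeZero ν]
    (X : Matrix (Fin γ × Fin ν) (Fin γ × Fin ν) ℝ) (hX : IsPermMatrix X) :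
    IsBlockPermMatrix X ↔
      ∀ k b : Fin γ, ∀ l : Fin ν,
        (∑ i, X (k, i) (b, l)) +
            ∑ k' ∈ Finset.univ.erase k, ∑ i, X (k', i) (b, l + 1) = 1 := by
  have hcol : ∀ b l, ∑ k, ∑ i, X (k, i) (b, l) = 1 := fun b l => by
    rw [← Fintype.sum_prod_type']
    exact hX.2.2 (b, l)
  have hsplit : ∀ k b l, ∑ i, X (k, i) (b, l) +
      ∑ k' ∈ Finset.univ.erase k, ∑ i, X (k', i) (b, l) = 1 := fun k b l => by
    rw [Finset.add_sum_erase _ (fun k => ∑ i, X (k, i) (b, l)) (Finset.mem_univ k), hcol]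
  have hnn : ∀ k b l, 0 ≤ ∑ i, X (k, i) (b, l) := fun k b l =>
    Finset.sum_nonneg fun i _ => hX.nonneg _ _
  constructor
  · intro hB k b l
    obtain ⟨k₀, -, huniq⟩ := hB b
    have hzero : ∀ k ≠ k₀, ∀ l, ∑ i, X (k, i) (b, l) = 0 := fun k hk l =>
      Finset.sum_eq_zero fun i _ => by
        by_contra hne
        exact hk (huniq k ⟨i, l, hne⟩)
    have hone : ∀ l, ∑ i, X (k₀, i) (b, l) = 1 := fun l => by
      rw [← hcol b l]
      exact (Fintype.sum_eq_single k₀ fun k hk => hzero k hk l).symm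
    have hconst : ∑ i, X (k, i) (b, l) = ∑ i, X (k, i) (b, l + 1) := by
      by_cases hk : k = k₀
      · rw [hk, hone, hone]
      · rw [hzero k hk, hzero k hk]
    rw [hconst, hsplit]
  · intro h b
    have hconst : ∀ k l, ∑ i, X (k, i) (b, l) = ∑ i, X (k, i) (b, 0) := fun k l =>
      Fin.eq_of_forall_eq_add_one (f := fun l => ∑ i, X (k, i) (b, l))
        (fun l => by linarith [h k b l, hsplit k b (l + 1)]) l
    obtain ⟨⟨k₀, i₀⟩, -, hne⟩ := Finset.exists_ne_zero_of_sum_ne_zero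
      (by rw [hX.2.2 (b, 0)]; exact one_ne_zero)
    refine ⟨k₀, ⟨i₀, 0, hne⟩, ?_⟩
    rintro k ⟨i, j, hij⟩
    by_contra hk
    have hle : ∀ k i l, X (k, i) (b, l) ≤ ∑ i, X (k, i) (b, l) := fun k i l =>
      Finset.single_le_sum (f := fun i => X (k, i) (b, l)) (fun i _ => hX.nonneg _ _)
        (Finset.mem_univ i)
    have hrest : ∑ i, X (k, i) (b, 0) ≤
        ∑ k' ∈ Finset.univ.erase k₀, ∑ i, X (k', i) (b, 0) :=
      Finset.single_le_sum (f := fun k => ∑ i, X (k, i) (b, 0)) (fun k _ => hnn k b 0)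
        (Finset.mem_erase.2 ⟨hk, Finset.mem_univ k⟩)
    have hX₀ : X (k₀, i₀) (b, 0) = 1 := (hX.1 _ _).resolve_left hne
    have hX₁ : X (k, i) (b, j) = 1 := (hX.1 _ _).resolve_left hij
    linarith [hle k₀ i₀ 0, hle k i j, hconst k j, hsplit k₀ b 0]
end

section
/- Minimum squared Euclidean distance of block permutation codes. Let γ, ν ≥ 1 and let s = (s₁,…,s_γ) with each s_k ∈ ℝ^ν. For a permutation π of {1,…,γ} and a family Q = (Q₁,…,Q_γ) of permutations of {1,…,ν}, define the codeword c(π,Q) ∈ ℝ^{γν} whose (k,l)-entry is s_{π(k)}(Q_k(l)); the block permutation code C(n,ν,s) is the set of all such codewords. Define Δ₁² = min over k ∈ {1,…,γ} and permutations Q ≠ id of {1,…,ν} of Σ_{l=1}^{ν} (s_k(l) − s_k(Q(l)))², and Δ₂² = min over k ≠ j and all permutations Q of {1,…,ν} of Σ_{l=1}^{ν} (s_k(l) − s_j(Q(l)))². If Δ₁² > 0 and Δ₂² > 0, then the minimum of ‖x − y‖² over distinct codewords x ≠ y of C(n,ν,s) equals min{ Δ₁², 2Δ₂² }. -/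
open Finset

/-- The codeword of the block permutation code determined by a permutation `π` of the
blocks and a family `Q` of within-block permutations: its `(k, l)` entry is
`s_{π(k)}(Q_k(l))`. -/
def blockCodeword {γ ν : ℕ} (s : Fin γ → Fin ν → ℝ)
    (π : Equiv.Perm (Fin γ)) (Q : Fin γ → Equiv.Perm (Fin ν)) :
    Fin γ × Fin ν → ℝ :=
  fun p => s (π p.1) (Q p.1 p.2)

/-- The squared distance between two blocks depends only on the relative permutation. -/
lemma sum_sq_sub_perm_eq {ι : Type*} [Fintype ι] (u v : ι → ℝ) (P R : Equiv.Perm ι) :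
    ∑ l, (u (P l) - v (R l)) ^ 2 = ∑ l, (u l - v ((R * P⁻¹) l)) ^ 2 := by
  rw [← Equiv.sum_comp P (fun l => (u l - v ((R * P⁻¹) l)) ^ 2)]
  simp

/-- The squared distance between codewords is the sum of the squared distances of blocks. -/
lemma sum_sq_sub_blockCodeword {γ ν : ℕ} (s : Fin γ → Fin ν → ℝ)
    (π π' : Equiv.Perm (Fin γ)) (Q Q' : Fin γ → Equiv.Perm (Fin ν)) :
    ∑ p : Fin γ × Fin ν, (blockCodeword s π Q p - blockCodeword s π' Q' p) ^ 2 =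
      ∑ k, ∑ l, (s (π k) l - s (π' k) ((Q' k * (Q k)⁻¹) l)) ^ 2 := by
  rw [Fintype.sum_prod_type]
  exact Finset.sum_congr rfl fun k _ =>
    sum_sq_sub_perm_eq (s (π k)) (s (π' k)) (Q k) (Q' k)

/-- Codewords at positive squared distance are distinct. -/
lemma blockCodeword_ne_of_sum_pos {γ ν : ℕ} {s : Fin γ → Fin ν → ℝ}
    {π π' : Equiv.Perm (Fin γ)} {Q Q' : Fin γ → Equiv.Perm (Fin ν)}
    (h : 0 < ∑ p : Fin γ × Fin ν, (blockCodeword s π Q p - blockCodeword s π' Q' p) ^ 2) :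
    blockCodeword s π Q ≠ blockCodeword s π' Q' := by
  intro he
  simp [he] at h

/-- Permuting a single block changes the codeword by the squared distance within that block. -/
lemma sum_sq_sub_blockCodeword_update {γ ν : ℕ} (s : Fin γ → Fin ν → ℝ)
    (k : Fin γ) (Q : Equiv.Perm (Fin ν)) :
    ∑ p : Fin γ × Fin ν, (blockCodeword s 1 1 p -
      blockCodeword s 1 (Function.update 1 k Q) p) ^ 2 = ∑ l, (s k l - s k (Q l)) ^ 2 := by
  rw [sum_sq_sub_blockCodeword, Finset.sum_eq_single k]
  · simp
  · intro i _ hi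
    simp [Function.update_of_ne hi]
  · simp

/-- Exchanging two blocks changes the codeword by twice the squared distance between them. -/
lemma sum_sq_sub_blockCodeword_swap {γ ν : ℕ} (s : Fin γ → Fin ν → ℝ)
    {k j : Fin γ} (hkj : k ≠ j) (Q : Equiv.Perm (Fin ν)) :
    ∑ p : Fin γ × Fin ν, (blockCodeword s 1 1 p - blockCodeword s (Equiv.swap k j)
      (Function.update (Function.update 1 k Q) j Q.symm) p) ^ 2 =
      2 * ∑ l, (s k l - s j (Q l)) ^ 2 := by
  have hsymm : ∑ l, (s j l - s k (Q.symm l)) ^ 2 = ∑ l, (s k l - s j (Q l)) ^ 2 := by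
    rw [← Equiv.sum_comp Q]
    refine Finset.sum_congr rfl fun l _ => ?_
    rw [Equiv.symm_apply_apply]
    ring
  rw [sum_sq_sub_blockCodeword, Fintype.sum_eq_add k j hkj]
  · simp [Function.update_of_ne hkj, hsymm, two_mul]
  · rintro i ⟨hik, hij⟩
    simp [Function.update_of_ne hik, Function.update_of_ne hij,
      Equiv.swap_apply_of_ne_of_ne hik hij]

/-- Two distinct permutations differ in at least two places. -/
lemma Equiv.Perm.exists_pair_apply_ne {α : Type*} {π π' : Equiv.Perm α} (h : π ≠ π') :
    ∃ i j, i ≠ j ∧ π i ≠ π' i ∧ π j ≠ π' j := by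
  obtain ⟨i, hi⟩ : ∃ i, π i ≠ π' i := by
    by_contra! hall
    exact h (Equiv.ext hall)
  have hij : i ≠ π.symm (π' i) := fun he => hi (π.eq_symm_apply.mp he)
  refine ⟨i, π.symm (π' i), hij, hi, ?_⟩
  rw [Equiv.apply_symm_apply]
  exact π'.injective.ne hij

/-- Minimum squared Euclidean distance of block permutation codes: if
`Δ₁² = min_{k, Q ≠ id} Σ_l (s_k(l) − s_k(Q(l)))²` and
`Δ₂² = min_{k ≠ j, Q} Σ_l (s_k(l) − s_j(Q(l)))²` are both positive, then the minimum of
`‖x − y‖²` over distinct codewords equals `min{Δ₁², 2Δ₂²}`. -/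
theorem stmt11 (γ ν : ℕ) (hγ : 1 ≤ γ) (hν : 1 ≤ ν) (s : Fin γ → Fin ν → ℝ)
    (Δ₁ Δ₂ : ℝ)
    (hΔ₁ : IsLeast {d : ℝ | ∃ (k : Fin γ) (Q : Equiv.Perm (Fin ν)),
      Q ≠ 1 ∧ d = ∑ l, (s k l - s k (Q l)) ^ 2} Δ₁)
    (hΔ₂ : IsLeast {d : ℝ | ∃ (k j : Fin γ) (Q : Equiv.Perm (Fin ν)),
      k ≠ j ∧ d = ∑ l, (s k l - s j (Q l)) ^ 2} Δ₂)
    (h₁ : 0 < Δ₁) (h₂ : 0 < Δ₂) :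
    IsLeast {d : ℝ | ∃ (π π' : Equiv.Perm (Fin γ))
        (Q Q' : Fin γ → Equiv.Perm (Fin ν)),
        blockCodeword s π Q ≠ blockCodeword s π' Q' ∧
        d = ∑ p : Fin γ × Fin ν,
          (blockCodeword s π Q p - blockCodeword s π' Q' p) ^ 2}
      (min Δ₁ (2 * Δ₂)) := by
  have hblock (π π' : Equiv.Perm (Fin γ)) (Q Q' : Fin γ → Equiv.Perm (Fin ν)) (k : Fin γ) :
      0 ≤ ∑ l, (s (π k) l - s (π' k) ((Q' k * (Q k)⁻¹) l)) ^ 2 := by positivity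
  constructor
  · rcases min_choice Δ₁ (2 * Δ₂) with hm | hm <;> rw [hm]
    · obtain ⟨k, Q, -, rfl⟩ := hΔ₁.1
      rw [← sum_sq_sub_blockCodeword_update] at h₁ ⊢
      exact ⟨_, _, _, _, blockCodeword_ne_of_sum_pos h₁, rfl⟩
    · obtain ⟨k, j, Q, hkj, rfl⟩ := hΔ₂.1
      have hpos := mul_pos two_pos h₂
      rw [← sum_sq_sub_blockCodeword_swap s hkj] at hpos ⊢
      exact ⟨_, _, _, _, blockCodeword_ne_of_sum_pos hpos, rfl⟩
  · rintro d ⟨π, π', Q, Q', hne, rfl⟩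
    rw [sum_sq_sub_blockCodeword]
    by_cases hπ : π = π'
    · subst hπ
      obtain ⟨k, hk⟩ : ∃ k, Q k ≠ Q' k := by
        by_contra! hall
        exact hne (by rw [funext hall])
      refine (min_le_left _ _).trans ?_
      refine le_trans ?_ (Finset.single_le_sum (fun i _ => hblock π π Q Q' i) (mem_univ k))
      exact hΔ₁.2 ⟨π k, _, fun he => hk (mul_inv_eq_one.mp he).symm, rfl⟩
    · obtain ⟨i, j, hij, hi, hj⟩ := Equiv.Perm.exists_pair_apply_ne hπ
      refine (min_le_right _ _).trans ?_
      refine le_trans ?_ (Finset.add_le_sum (fun i _ => hblock π π' Q Q' i)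
        (mem_univ i) (mem_univ j) hij)
      rw [two_mul]
      exact add_le_add (hΔ₂.2 ⟨_, _, _, hi, rfl⟩) (hΔ₂.2 ⟨_, _, _, hj, rfl⟩)
end

section
/- Average weight distribution of random LP decodable permutation codes. Let n ≥ 2, m ≥ 0, and w ≤ n. Let 𝒫 denote the family of 2-element subsets of {1,…,n}×{1,…,n}, and for f : {1,…,m} → 𝒫 let L_w(f) be the number of n×n permutation matrices X such that (i) for every r ∈ {1,…,m} the two entries of X at the two positions of f(r) are equal, and (ii) the permutation σ represented by X has exactly w non-fixed points. Then Σ over all functions f : {1,…,m} → 𝒫 of L_w(f) equals C(n,w) · D_w · ( C(n,2) + C(n²−n,2) )^m, where D_w is the number of derangements of a w-element set. Equivalently, the expected number of codewords of Hamming weight w equals C(n,w) · D_w · ( (C(n,2)+C(n²−n,2)) / C(n²,2) )^m. -/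
open Matrix Finset

/-- The 2-element subsets on which membership in `S` is constant are those contained in `S` or
in its complement. -/
lemma card_filter_pairs_mem_iff {α : Type*} [Fintype α] [DecidableEq α] (S : Finset α) :
    #{P : {P : Finset α // P.card = 2} | ∀ p ∈ P.1, ∀ q ∈ P.1, (p ∈ S ↔ q ∈ S)} =
      (#S).choose 2 + (#Sᶜ).choose 2 := by
  rw [← card_powersetCard, ← card_powersetCard, ← card_union_of_disjoint]
  · refine card_bij (fun P _ => P.1) ?_ (fun _ _ _ _ h => Subtype.ext h) ?_
    · rintro ⟨P, hP⟩ h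
      simp only [mem_filter, mem_univ, true_and] at h
      simp only [mem_union, mem_powersetCard, hP, and_true]
      obtain ⟨a, ha⟩ : P.Nonempty := card_pos.1 (by omega)
      by_cases haS : a ∈ S
      · exact .inl fun q hq => (h a ha q hq).1 haS
      · exact .inr fun q hq => mem_compl.2 fun hqS => haS ((h a ha q hq).2 hqS)
    · intro P hP
      simp only [mem_union, mem_powersetCard] at hP
      refine ⟨⟨P, by tauto⟩, ?_, rfl⟩
      simp only [mem_filter, mem_univ, true_and]
      rcases hP with ⟨h, -⟩ | ⟨h, -⟩ <;> intro p hp q hq <;> have h1 := h hp <;> have h2 := h hq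
      · simp [h1, h2]
      · simp [mem_compl.1 h1, mem_compl.1 h2]
  · rw [disjoint_left]
    intro P hP hP'
    rw [mem_powersetCard] at hP hP'
    obtain ⟨a, ha⟩ : P.Nonempty := card_pos.1 (by omega)
    exact mem_compl.1 (hP'.1 ha) (hP.1 ha)

/-- The number of permutations with support `S` is the number of derangements of `S`. -/
lemma card_filter_perm_support_eq {α : Type*} [Fintype α] [DecidableEq α] (S : Finset α) :
    #{σ : Equiv.Perm α | σ.support = S} = numDerangements #S := by
  have h := Fintype.card_congr (derangements.subtypeEquiv (· ∈ S))
  rw [card_derangements_eq_numDerangements, Fintype.card_coe] at h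
  rw [h, Fintype.card_subtype]
  congr 1
  ext σ
  simp only [mem_filter, mem_univ, true_and, Finset.ext_iff, Equiv.Perm.mem_support,
    Function.mem_fixedPoints, Function.IsFixedPt]
  exact forall_congr' fun a => by tauto

/-- The number of permutations with exactly `w` non-fixed points. -/
lemma card_filter_perm_card_support_eq {α : Type*} [Fintype α] [DecidableEq α] (w : ℕ) :
    #{σ : Equiv.Perm α | #σ.support = w} = (Fintype.card α).choose w * numDerangements w := by
  rw [card_eq_sum_card_fiberwise (f := Equiv.Perm.support) (t := powersetCard w univ)
    fun σ hσ => by simpa using hσ]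
  rw [← card_univ, ← card_powersetCard, ← smul_eq_mul]
  refine sum_eq_card_nsmul fun S hS => ?_
  rw [mem_powersetCard] at hS
  rw [← hS.2, ← card_filter_perm_support_eq, filter_filter]
  congr 1
  ext σ
  simp only [mem_filter, mem_univ, true_and, and_iff_right_iff_imp]
  rintro rfl
  rfl

/-- The set of positions of the ones in the permutation matrix of `σ`. -/
def permPositions {n : ℕ} (σ : Equiv.Perm (Fin n)) : Finset (Fin n × Fin n) :=
  {p | σ p.2 = p.1}

lemma card_permPositions {n : ℕ} (σ : Equiv.Perm (Fin n)) : #(permPositions σ) = n := by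
  have : permPositions σ = univ.image fun j => (σ j, j) := by
    ext ⟨i, j⟩
    simp [permPositions]
  rw [this, card_image_of_injective _ fun a b h => (Prod.ext_iff.1 h).2, card_fin]

lemma card_constrained_permutation_matrices {n m w : ℕ}
    (f : Fin m → {P : Finset (Fin n × Fin n) // P.card = 2}) :
    Nat.card {X : Matrix (Fin n) (Fin n) ℝ //
        (∀ r : Fin m, ∀ p ∈ (f r).1, ∀ q ∈ (f r).1, X p.1 p.2 = X q.1 q.2) ∧
        ∃ σ : Equiv.Perm (Fin n),
          (∀ i j, X i j = if σ j = i then 1 else 0) ∧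
          Nat.card {i : Fin n // σ i ≠ i} = w} =
      #{σ : Equiv.Perm (Fin n) | #σ.support = w ∧ ∀ r, ∀ p ∈ (f r).1, ∀ q ∈ (f r).1,
        (p ∈ permPositions σ ↔ q ∈ permPositions σ)} := by
  have hsupp (σ : Equiv.Perm (Fin n)) : Nat.card {i : Fin n // σ i ≠ i} = #σ.support := by
    rw [Nat.card_eq_fintype_card, Fintype.card_subtype]
    rfl
  have hentry (σ : Equiv.Perm (Fin n)) (p q : Fin n × Fin n) :
      ((if σ p.2 = p.1 then 1 else 0 : ℝ) = if σ q.2 = q.1 then 1 else 0) ↔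
        (p ∈ permPositions σ ↔ q ∈ permPositions σ) := by
    simp only [permPositions, mem_filter, mem_univ, true_and]
    split_ifs <;> simp_all
  refine Eq.trans ?_ (Nat.subtype_card _ fun σ => mem_filter_univ σ)
  symm
  refine Nat.card_congr (Equiv.ofBijective (fun σ => ⟨fun i j => if σ.1 j = i then 1 else 0,
    fun r p hp q hq => (hentry _ p q).2 (σ.2.2 r p hp q hq),
    σ.1, fun _ _ => rfl, (hsupp _).trans σ.2.1⟩) ⟨?_, ?_⟩)
  · rintro ⟨σ, hσ⟩ ⟨τ, hτ⟩ h
    refine Subtype.ext (Equiv.ext fun j => ?_)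
    have h := congrFun (congrFun (congrArg Subtype.val h) (σ j)) j
    by_contra hne
    simp [Ne.symm hne] at h
  · rintro ⟨X, hX, σ, hσ, hw⟩
    refine ⟨⟨σ, (hsupp σ).symm.trans hw, fun r p hp q hq => (hentry σ p q).1 ?_⟩, ?_⟩
    · rw [← hσ, ← hσ]
      exact hX r p hp q hq
    · exact Subtype.ext (funext fun i => funext fun j => (hσ i j).symm)

/-- Average weight distribution of random LP decodable permutation codes: summing, over
all assignments `f` of a 2-element set of positions to each of the `m` random equality
constraints, the number `L_w(f)` of permutation matrices satisfying the constraints and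
representing a permutation with exactly `w` non-fixed points, yields
`C(n,w) · D_w · (C(n,2) + C(n²−n,2))^m`, where `D_w` is the number of derangements of a
`w`-element set. -/
theorem stmt16 (n m w : ℕ) (hn : 2 ≤ n) (hw : w ≤ n) :
    ∑ f : Fin m → {P : Finset (Fin n × Fin n) // P.card = 2},
      Nat.card {X : Matrix (Fin n) (Fin n) ℝ //
        (∀ r : Fin m, ∀ p ∈ (f r).1, ∀ q ∈ (f r).1, X p.1 p.2 = X q.1 q.2) ∧
        ∃ σ : Equiv.Perm (Fin n),
          (∀ i j, X i j = if σ j = i then 1 else 0) ∧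
          Nat.card {i : Fin n // σ i ≠ i} = w}
    = n.choose w * Nat.card {σ : Equiv.Perm (Fin w) // ∀ i, σ i ≠ i} *
        (n.choose 2 + (n ^ 2 - n).choose 2) ^ m := by
  have hder : Nat.card {σ : Equiv.Perm (Fin w) // ∀ i, σ i ≠ i} = numDerangements w := by
    rw [← card_derangements_fin_eq_numDerangements, ← Nat.card_eq_fintype_card]
    rfl
  have hcount (σ : Equiv.Perm (Fin n)) :
      #{f : Fin m → {P : Finset (Fin n × Fin n) // P.card = 2} | ∀ r, ∀ p ∈ (f r).1,
        ∀ q ∈ (f r).1, (p ∈ permPositions σ ↔ q ∈ permPositions σ)} =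
      (n.choose 2 + (n ^ 2 - n).choose 2) ^ m := by
    have h := card_filter_pairs_mem_iff (permPositions σ)
    rw [card_compl, card_permPositions, Fintype.card_prod, Fintype.card_fin, ← sq] at h
    rw [← h, ← Fintype.card_piFinset_const]
    congr 1
    ext f
    simp [Fintype.mem_piFinset]
  simp_rw [card_constrained_permutation_matrices, hder]
  rw [← Fintype.card_fin n, ← card_filter_perm_card_support_eq, Fintype.card_fin, ← smul_eq_mul]
  simp_rw [← filter_filter]
  refine (sum_card_bipartiteAbove_eq_sum_card_bipartiteBelow fun
    (f : Fin m → {P : Finset (Fin n × Fin n) // P.card = 2}) (σ : Equiv.Perm (Fin n)) =>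
      ∀ r, ∀ p ∈ (f r).1, ∀ q ∈ (f r).1,
        (p ∈ permPositions σ ↔ q ∈ permPositions σ)).trans ?_
  exact sum_eq_card_nsmul fun σ _ => hcount σ
end
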